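/- arXiv:2104.06839 — 9 statements merged into one kernel-verified Lean document; each statement's English description precedes it below -/
import Mathlib

section
/- Let Θ be a finite set, m a basic probability assignment on Θ and Bel its belief function. Then Bel is monotone of order k for every k ≥ 1: for every finite family A_1, ..., A_k of subsets of Θ, Bel(A_1 ∪ ... ∪ A_k) ≥ ∑_{∅ ≠ K ⊆ {1,...,k}} (−1)^{|K|+1} · Bel(⋂_{j ∈ K} A_j). -/
/-- Belief functions are monotone of every order `k ≥ 1`. -/
theorem belief_k_monotone {Θ : Type*} [Fintype Θ] [DecidableEq Θ]
    (m : Finset Θ → ℝ)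
    (hm0 : m ∅ = 0) (hmnn : ∀ A : Finset Θ, 0 ≤ m A)
    (hmsum : ∑ A : Finset Θ, m A = 1)
    (Bel : Finset Θ → ℝ) (hBel : ∀ A : Finset Θ, Bel A = ∑ B ∈ A.powerset, m B)
    (k : ℕ) (hk : 1 ≤ k) (A : Fin k → Finset Θ) :
    ∑ K ∈ Finset.univ.filter (fun K : Finset (Fin k) => K ≠ ∅),
        (-1 : ℝ) ^ (K.card + 1) * Bel (K.inf A)
      ≤ Bel (Finset.univ.sup A) := by
  have hle : ∑ B ∈ Finset.univ.biUnion (fun i => (A i).powerset), m B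
      ≤ Bel (Finset.univ.sup A) := by
    rw [hBel]
    refine Finset.sum_le_sum_of_subset_of_nonneg (fun B hB => ?_) fun B _ _ => hmnn B
    obtain ⟨i, -, hi⟩ := Finset.mem_biUnion.mp hB
    exact Finset.mem_powerset.mpr
      ((Finset.mem_powerset.mp hi).trans (Finset.le_sup (f := A) (Finset.mem_univ i)))
  refine le_trans (le_of_eq ?_) hle
  rw [Finset.inclusion_exclusion_sum_biUnion]
  symm
  refine Finset.sum_bij (fun K _ => K.1) ?_ ?_ ?_ ?_
  · intro K _
    have hK := (Finset.mem_filter.mp K.2).2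
    simpa using hK.ne_empty
  · intro K _ L _ h
    exact Subtype.ext h
  · intro K hK
    have hne := Finset.nonempty_iff_ne_empty.mpr (Finset.mem_filter.mp hK).2
    exact ⟨⟨K, by simpa using hne⟩, Finset.mem_univ _, rfl⟩
  · intro K _
    rw [hBel, zsmul_eq_mul]
    push_cast
    congr 2
    ext B
    simp [Finset.mem_inf', Finset.le_inf_iff]
end

section
/- Let Θ be a finite nonempty set, m a basic probability assignment on Θ and Bel its belief function. Then the credal set P[Bel] = { p probability distribution on Θ : P(A) ≥ Bel(A) for all A ⊆ Θ } is nonempty, and Bel is its lower envelope: for every A ⊆ Θ there exists p ∈ P[Bel] with P(A) = Bel(A), so that Bel(A) = min_{p ∈ P[Bel]} P(A). -/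
/-- The probability of `A` under the weights obtained by moving the mass of each set `B` to the
single point `s B`. -/
theorem sum_sum_ite_selection_eq {Θ : Type*} [Fintype Θ] [DecidableEq Θ]
    (m : Finset Θ → ℝ) (s : Finset Θ → Θ) (A : Finset Θ) :
    ∑ x ∈ A, ∑ B : Finset Θ, (if s B = x then m B else 0) =
      ∑ B : Finset Θ, if s B ∈ A then m B else 0 := by
  rw [Finset.sum_comm]
  simp

/-- For every set `A` there is a selection of a point from each nonempty set which avoids `A`
whenever possible. -/
theorem exists_selection_avoiding {Θ : Type*} [Nonempty Θ] (A : Finset Θ) :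
    ∃ s : Finset Θ → Θ, (∀ B : Finset Θ, B.Nonempty → s B ∈ B) ∧
      ∀ B : Finset Θ, s B ∈ A → B ⊆ A := by
  have h (B : Finset Θ) : ∃ x, (B.Nonempty → x ∈ B) ∧ (x ∈ A → B ⊆ A) := by
    by_cases hBA : B ⊆ A
    · rcases B.eq_empty_or_nonempty with rfl | ⟨x, hx⟩
      · exact ⟨Classical.arbitrary Θ, by simp, by simp⟩
      · exact ⟨x, fun _ => hx, fun _ => hBA⟩
    · obtain ⟨x, hxB, hxA⟩ := Finset.not_subset.mp hBA
      exact ⟨x, fun _ => hxB, fun h => absurd h hxA⟩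
  choose s hs hsA using h
  exact ⟨s, hs, hsA⟩


/-- The credal set of a belief function is nonempty, and the belief function is its
lower envelope (the minimum is attained for every event). -/
theorem belief_lower_envelope_of_credal_set {Θ : Type*} [Fintype Θ] [DecidableEq Θ]
    [Nonempty Θ]
    (m : Finset Θ → ℝ)
    (hm0 : m ∅ = 0) (hmnn : ∀ A : Finset Θ, 0 ≤ m A)
    (hmsum : ∑ A : Finset Θ, m A = 1)
    (Bel : Finset Θ → ℝ) (hBel : ∀ A : Finset Θ, Bel A = ∑ B ∈ A.powerset, m B) :
    (∃ p : Θ → ℝ, (∀ x, 0 ≤ p x) ∧ (∑ x, p x) = 1 ∧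
        ∀ A : Finset Θ, Bel A ≤ ∑ x ∈ A, p x) ∧
    ∀ A : Finset Θ,
      IsLeast {r : ℝ | ∃ p : Θ → ℝ, (∀ x, 0 ≤ p x) ∧ (∑ x, p x) = 1 ∧
        (∀ B : Finset Θ, Bel B ≤ ∑ x ∈ B, p x) ∧ r = ∑ x ∈ A, p x} (Bel A) := by
  have hBel' (A : Finset Θ) : Bel A = ∑ B : Finset Θ, if B ⊆ A then m B else 0 := by
    rw [hBel, ← Finset.sum_filter]
    congr 1
    ext B
    simp
  have attained (A : Finset Θ) : ∃ p : Θ → ℝ, (∀ x, 0 ≤ p x) ∧ (∑ x, p x) = 1 ∧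
      (∀ B : Finset Θ, Bel B ≤ ∑ x ∈ B, p x) ∧ Bel A = ∑ x ∈ A, p x := by
    obtain ⟨s, hs, hsA⟩ := exists_selection_avoiding A
    have le (C : Finset Θ) :
        Bel C ≤ ∑ x ∈ C, ∑ B : Finset Θ, (if s B = x then m B else 0) := by
      rw [hBel', sum_sum_ite_selection_eq]
      refine Finset.sum_le_sum fun B _ => ?_
      rcases B.eq_empty_or_nonempty with rfl | hB
      · simp [hm0]
      · by_cases hBC : B ⊆ C
        · simp [hBC, hBC (hs B hB)]
        · rw [if_neg hBC]
          split_ifs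
          exacts [hmnn B, le_rfl]
    refine ⟨fun x => ∑ B : Finset Θ, if s B = x then m B else 0, fun x => ?_, ?_, le,
      (le A).antisymm ?_⟩
    · exact Finset.sum_nonneg fun B _ => by split_ifs; exacts [hmnn B, le_rfl]
    · rw [sum_sum_ite_selection_eq]
      simpa using hmsum
    · rw [hBel', sum_sum_ite_selection_eq]
      refine Finset.sum_le_sum fun B _ => ?_
      by_cases hBA : s B ∈ A
      · simp [hBA, hsA B hBA]
      · rw [if_neg hBA]
        split_ifs
        exacts [hmnn B, le_rfl]
  refine ⟨?_, fun A => ⟨attained A, ?_⟩⟩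
  · obtain ⟨p, hp0, hp1, hp, -⟩ := attained ∅
    exact ⟨p, hp0, hp1, hp⟩
  · rintro _ ⟨p, -, -, hp, rfl⟩
    exact hp A
end

section
/- Let Θ be a finite set and m a basic probability assignment on Θ with plausibility function Pl. Then the following are equivalent: (i) m is consonant, i.e. the focal elements of m are nested (totally ordered by inclusion); (ii) Pl is maxitive, i.e. Pl(A ∪ B) = max(Pl(A), Pl(B)) for all A, B ⊆ Θ (so Pl is a possibility measure). -/
/-- If every focal element meeting `A` also meets `B`, then `A` is at most as plausible as `B`. -/
theorem sum_filter_inter_nonempty_le {Θ : Type*} [Fintype Θ] [DecidableEq Θ]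
    {m : Finset Θ → ℝ} (hm : ∀ A, 0 ≤ m A) {A B : Finset Θ}
    (h : ∀ C, 0 < m C → (C ∩ A).Nonempty → (C ∩ B).Nonempty) :
    ∑ C ∈ Finset.univ.filter (fun C : Finset Θ => (C ∩ A).Nonempty), m C ≤
      ∑ C ∈ Finset.univ.filter (fun C : Finset Θ => (C ∩ B).Nonempty), m C := by
  simp only [Finset.sum_filter]
  refine Finset.sum_le_sum fun C _ => ?_
  have hC := h C
  have hC0 := hm C
  split_ifs with hA hB
  · exact le_rfl
  · exact not_lt.1 fun hpos => hB (hC hpos hA)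
  · exact hC0
  · exact le_rfl

/-- If some focal element meets `B ⊇ A` but not `A`, then `A` is less plausible than `B`. -/
theorem sum_filter_inter_nonempty_lt {Θ : Type*} [Fintype Θ] [DecidableEq Θ]
    {m : Finset Θ → ℝ} (hm : ∀ A, 0 ≤ m A) {A B C : Finset Θ} (hAB : A ⊆ B)
    (hC : 0 < m C) (hCB : (C ∩ B).Nonempty) (hCA : ¬ (C ∩ A).Nonempty) :
    ∑ D ∈ Finset.univ.filter (fun D : Finset Θ => (D ∩ A).Nonempty), m D <
      ∑ D ∈ Finset.univ.filter (fun D : Finset Θ => (D ∩ B).Nonempty), m D := by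
  refine Finset.sum_lt_sum_of_subset (i := C) (fun D hD => ?_) (by simpa using hCB)
    (by simpa using hCA) hC fun D _ _ => hm D
  simp only [Finset.mem_filter, Finset.mem_univ, true_and] at hD ⊢
  exact hD.mono (Finset.inter_subset_inter_left hAB)

/-- A mass assignment is consonant (nested focal elements) iff its plausibility
function is maxitive, i.e. a possibility measure. -/
theorem consonant_iff_plausibility_maxitive {Θ : Type*} [Fintype Θ] [DecidableEq Θ]
    (m : Finset Θ → ℝ)
    (hm0 : m ∅ = 0) (hmnn : ∀ A : Finset Θ, 0 ≤ m A)
    (hmsum : ∑ A : Finset Θ, m A = 1)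
    (Pl : Finset Θ → ℝ)
    (hPl : ∀ A : Finset Θ,
      Pl A = ∑ B ∈ Finset.univ.filter (fun B : Finset Θ => (B ∩ A).Nonempty), m B) :
    (∀ A B : Finset Θ, 0 < m A → 0 < m B → A ⊆ B ∨ B ⊆ A) ↔
    (∀ A B : Finset Θ, Pl (A ∪ B) = max (Pl A) (Pl B)) := by
  constructor
  · intro hnest A B
    have mono {S T : Finset Θ} (h : ∀ C, 0 < m C → (C ∩ S).Nonempty → (C ∩ T).Nonempty) :
        Pl S ≤ Pl T := by
      rw [hPl, hPl]
      exact sum_filter_inter_nonempty_le hmnn h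
    refine le_antisymm ?_ (max_le
      (mono fun C _ h => h.mono (Finset.inter_subset_inter_left Finset.subset_union_left))
      (mono fun C _ h => h.mono (Finset.inter_subset_inter_left Finset.subset_union_right)))
    by_cases hBA : ∀ C, 0 < m C → (C ∩ B).Nonempty → (C ∩ A).Nonempty
    · refine le_max_of_le_left (mono fun C hC h => ?_)
      rw [Finset.inter_union_distrib_left, Finset.union_nonempty] at h
      exact h.elim id (hBA C hC)
    · push Not at hBA
      obtain ⟨D, hD, hDB, hDA⟩ := hBA
      refine le_max_of_le_right (mono fun C hC h => ?_)
      rw [Finset.inter_union_distrib_left, Finset.union_nonempty] at h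
      refine h.elim (fun hCA => ?_) id
      rcases hnest C D hC hD with hCD | hDC
      · exact absurd hDA (hCA.mono (Finset.inter_subset_inter_right hCD)).ne_empty
      · exact hDB.mono (Finset.inter_subset_inter_right hDC)
  · intro hmax A B hA hB
    by_contra! hAB
    obtain ⟨a, haA, haB⟩ := Finset.not_subset.1 hAB.1
    obtain ⟨b, hbB, hbA⟩ := Finset.not_subset.1 hAB.2
    have ha : Pl {a} < Pl ({a} ∪ {b}) := by
      rw [hPl, hPl]
      exact sum_filter_inter_nonempty_lt hmnn Finset.subset_union_left hB
        ⟨b, by simp [hbB]⟩ (by simp [haB])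
    have hb : Pl {b} < Pl ({a} ∪ {b}) := by
      rw [hPl, hPl]
      exact sum_filter_inter_nonempty_lt hmnn Finset.subset_union_right hA
        ⟨a, by simp [haA]⟩ (by simp [hbA])
    exact (max_lt ha hb).ne' (hmax {a} {b})
end

section
/- Let Θ be a finite nonempty set and l, u : Θ → ℝ with 0 ≤ l(x) ≤ u(x) ≤ 1 for all x, satisfying the reachability conditions: for every x ∈ Θ, ∑_{y ≠ x} l(y) + u(x) ≤ 1 and ∑_{y ≠ x} u(y) + l(x) ≥ 1. Then the credal set P(l,u) = { p probability distribution on Θ : l(x) ≤ p(x) ≤ u(x) for all x } is nonempty and, for every A ⊆ Θ, min_{p ∈ P(l,u)} P(A) = max { ∑_{x ∈ A} l(x), 1 − ∑_{x ∉ A} u(x) } and max_{p ∈ P(l,u)} P(A) = min { ∑_{x ∈ A} u(x), 1 − ∑_{x ∉ A} l(x) }. -/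
/-- Every value between the sums of the two bounds over `s` is the sum over `s` of a function
lying pointwise between the bounds. -/
lemma exists_between_sum_eq {ι : Type*} {l u : ι → ℝ} (hlu : ∀ x, l x ≤ u x) (s : Finset ι)
    {t : ℝ} (ht₁ : ∑ x ∈ s, l x ≤ t) (ht₂ : t ≤ ∑ x ∈ s, u x) :
    ∃ p : ι → ℝ, (∀ x, l x ≤ p x ∧ p x ≤ u x) ∧ ∑ x ∈ s, p x = t := by
  have hcont : ContinuousOn (fun c : ℝ => ∑ x ∈ s, (l x + c * (u x - l x))) (Set.Icc 0 1) := by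
    fun_prop
  obtain ⟨c, ⟨hc₀, hc₁⟩, hc⟩ := intermediate_value_Icc zero_le_one hcont
    (show t ∈ Set.Icc _ _ by constructor <;> simpa)
  refine ⟨fun x => l x + c * (u x - l x), fun x => ⟨?_, ?_⟩, hc⟩
  · nlinarith [hlu x]
  · nlinarith [hlu x]

/-- The values attained on an event by the probability distributions between `l` and `u`. -/
lemma exists_distribution_sum_eq_iff {Θ : Type*} [Fintype Θ] [DecidableEq Θ] {l u : Θ → ℝ}
    (hl : ∀ x, 0 ≤ l x) (hlu : ∀ x, l x ≤ u x) (A : Finset Θ) (r : ℝ) :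
    (∃ p : Θ → ℝ, (∀ x, 0 ≤ p x) ∧ (∑ x, p x) = 1 ∧
      (∀ x, l x ≤ p x ∧ p x ≤ u x) ∧ r = ∑ x ∈ A, p x) ↔
    (∑ x ∈ A, l x ≤ r ∧ r ≤ ∑ x ∈ A, u x) ∧
      (∑ x ∈ Aᶜ, l x ≤ 1 - r ∧ 1 - r ≤ ∑ x ∈ Aᶜ, u x) := by
  constructor
  · rintro ⟨p, -, hp, hb, rfl⟩
    have hcompl : 1 - ∑ x ∈ A, p x = ∑ x ∈ Aᶜ, p x := by
      rw [← hp, ← Finset.sum_add_sum_compl A p, add_sub_cancel_left]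
    rw [hcompl]
    exact ⟨⟨Finset.sum_le_sum fun x _ => (hb x).1, Finset.sum_le_sum fun x _ => (hb x).2⟩,
      Finset.sum_le_sum fun x _ => (hb x).1, Finset.sum_le_sum fun x _ => (hb x).2⟩
  · rintro ⟨⟨h₁, h₂⟩, h₃, h₄⟩
    obtain ⟨p, hp, hpA⟩ := exists_between_sum_eq hlu A h₁ h₂
    obtain ⟨q, hq, hqA⟩ := exists_between_sum_eq hlu Aᶜ h₃ h₄
    have hA : ∑ x ∈ A, A.piecewise p q x = r := by
      rw [← hpA]
      exact Finset.sum_congr rfl fun x hx => Finset.piecewise_eq_of_mem _ _ _ hx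
    have hAc : ∑ x ∈ Aᶜ, A.piecewise p q x = 1 - r := by
      rw [← hqA]
      exact Finset.sum_congr rfl fun x hx =>
        Finset.piecewise_eq_of_notMem _ _ _ (Finset.mem_compl.1 hx)
    have hb : ∀ x, l x ≤ A.piecewise p q x ∧ A.piecewise p q x ≤ u x := fun x => by
      by_cases hx : x ∈ A
      · simpa [hx] using hp x
      · simpa [hx] using hq x
    refine ⟨A.piecewise p q, fun x => (hl x).trans (hb x).1, ?_, hb, hA.symm⟩
    rw [← Finset.sum_add_sum_compl A, hA, hAc, add_sub_cancel]


/-- For a reachable (feasible) set of probability intervals, the credal set is nonempty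
and the lower/upper probabilities of any event are given by de Campos' formulas. -/
theorem probability_intervals_envelopes {Θ : Type*} [Fintype Θ] [DecidableEq Θ]
    [Nonempty Θ]
    (l u : Θ → ℝ)
    (hl : ∀ x, 0 ≤ l x) (hlu : ∀ x, l x ≤ u x) (hu : ∀ x, u x ≤ 1)
    (hreach₁ : ∀ x : Θ, (∑ y ∈ Finset.univ.erase x, l y) + u x ≤ 1)
    (hreach₂ : ∀ x : Θ, 1 ≤ (∑ y ∈ Finset.univ.erase x, u y) + l x) :
    (∃ p : Θ → ℝ, (∀ x, 0 ≤ p x) ∧ (∑ x, p x) = 1 ∧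
        ∀ x, l x ≤ p x ∧ p x ≤ u x) ∧
    ∀ A : Finset Θ,
      IsLeast {r : ℝ | ∃ p : Θ → ℝ, (∀ x, 0 ≤ p x) ∧ (∑ x, p x) = 1 ∧
          (∀ x, l x ≤ p x ∧ p x ≤ u x) ∧ r = ∑ x ∈ A, p x}
        (max (∑ x ∈ A, l x) (1 - ∑ x ∈ Aᶜ, u x)) ∧
      IsGreatest {r : ℝ | ∃ p : Θ → ℝ, (∀ x, 0 ≤ p x) ∧ (∑ x, p x) = 1 ∧
          (∀ x, l x ≤ p x ∧ p x ≤ u x) ∧ r = ∑ x ∈ A, p x}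
        (min (∑ x ∈ A, u x) (1 - ∑ x ∈ Aᶜ, l x)) := by
  obtain ⟨x₀⟩ := ‹Nonempty Θ›
  have hL : ∑ x, l x ≤ 1 := by
    rw [← Finset.sum_erase_add _ _ (Finset.mem_univ x₀)]
    linarith [hreach₁ x₀, hlu x₀]
  have hU : 1 ≤ ∑ x, u x := by
    rw [← Finset.sum_erase_add _ _ (Finset.mem_univ x₀)]
    linarith [hreach₂ x₀, hlu x₀]
  refine ⟨?_, fun A => ?_⟩
  · obtain ⟨p, hp, hsum⟩ := exists_between_sum_eq hlu Finset.univ hL hU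
    exact ⟨p, fun x => (hl x).trans (hp x).1, hsum, hp⟩
  · simp_rw [exists_distribution_sum_eq_iff hl hlu]
    rw [← Finset.sum_add_sum_compl A] at hL hU
    have hA : ∑ x ∈ A, l x ≤ ∑ x ∈ A, u x := Finset.sum_le_sum fun x _ => hlu x
    have hAc : ∑ x ∈ Aᶜ, l x ≤ ∑ x ∈ Aᶜ, u x := Finset.sum_le_sum fun x _ => hlu x
    refine ⟨⟨⟨⟨le_max_left _ _, max_le hA (by linarith)⟩, ?_, ?_⟩, ?_⟩,
      ⟨⟨⟨le_min hA (by linarith), min_le_left _ _⟩, ?_, ?_⟩, ?_⟩⟩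
    · rw [le_sub_comm]
      exact max_le (by linarith) (by linarith)
    · rw [sub_le_comm]
      exact le_max_right _ _
    · rintro r ⟨⟨h₁, -⟩, -, h₂⟩
      exact max_le h₁ (by linarith)
    · rw [le_sub_comm]
      exact min_le_right _ _
    · rw [sub_le_comm]
      exact le_min (by linarith) (by linarith)
    · rintro r ⟨⟨-, h₁⟩, h₂, -⟩
      exact le_min h₁ (by linarith)
end

section
/- Let Θ be a finite nonempty set and l, u : Θ → ℝ with 0 ≤ l(x) ≤ u(x) ≤ 1 for all x, satisfying the reachability conditions: for every x ∈ Θ, ∑_{y ≠ x} l(y) + u(x) ≤ 1 and ∑_{y ≠ x} u(y) + l(x) ≥ 1. Define the lower probability P_(A) = max { ∑_{x ∈ A} l(x), 1 − ∑_{x ∉ A} u(x) } for A ⊆ Θ. Then P_ is a 2-monotone capacity: P_(A ∪ B) + P_(A ∩ B) ≥ P_(A) + P_(B) for all A, B ⊆ Θ. -/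
/-- The lower probability associated with a reachable set of probability intervals
is a 2-monotone capacity. -/
theorem probability_intervals_two_monotone {Θ : Type*} [Fintype Θ] [DecidableEq Θ]
    [Nonempty Θ]
    (l u : Θ → ℝ)
    (hl : ∀ x, 0 ≤ l x) (hlu : ∀ x, l x ≤ u x) (hu : ∀ x, u x ≤ 1)
    (hreach₁ : ∀ x : Θ, (∑ y ∈ Finset.univ.erase x, l y) + u x ≤ 1)
    (hreach₂ : ∀ x : Θ, 1 ≤ (∑ y ∈ Finset.univ.erase x, u y) + l x)
    (Plow : Finset Θ → ℝ)
    (hPlow : ∀ A : Finset Θ, Plow A = max (∑ x ∈ A, l x) (1 - ∑ x ∈ Aᶜ, u x)) :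
    ∀ A B : Finset Θ, Plow A + Plow B ≤ Plow (A ∪ B) + Plow (A ∩ B) := by
  intro A B
  have hL := Finset.sum_union_inter (s₁ := A) (s₂ := B) (f := l)
  have hU := Finset.sum_union_inter (s₁ := A) (s₂ := B) (f := u)
  have hgap {S T : Finset Θ} (h : S ⊆ T) :
      ∑ x ∈ S, u x - ∑ x ∈ S, l x ≤ ∑ x ∈ T, u x - ∑ x ∈ T, l x := by
    simpa only [Finset.sum_sub_distrib] using
      Finset.sum_le_sum_of_subset_of_nonneg (f := fun x => u x - l x) h
        fun x _ _ => sub_nonneg.2 (hlu x)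
  have hA := hgap (Finset.subset_union_left (s₁ := A) (s₂ := B))
  have hB := hgap (Finset.subset_union_right (s₁ := A) (s₂ := B))
  have hcompl (S : Finset Θ) : ∑ x ∈ Sᶜ, u x = ∑ x, u x - ∑ x ∈ S, u x :=
    eq_sub_of_add_eq (Finset.sum_compl_add_sum S u)
  simp only [hPlow, hcompl]
  have hl_union := le_max_left (∑ x ∈ A ∪ B, l x) (1 - (∑ x, u x - ∑ x ∈ A ∪ B, u x))
  have hu_union := le_max_right (∑ x ∈ A ∪ B, l x) (1 - (∑ x, u x - ∑ x ∈ A ∪ B, u x))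
  have hl_inter := le_max_left (∑ x ∈ A ∩ B, l x) (1 - (∑ x, u x - ∑ x ∈ A ∩ B, u x))
  have hu_inter := le_max_right (∑ x ∈ A ∩ B, l x) (1 - (∑ x, u x - ∑ x ∈ A ∩ B, u x))
  rcases max_choice (∑ x ∈ A, l x) (1 - (∑ x, u x - ∑ x ∈ A, u x)) with h | h <;>
    rcases max_choice (∑ x ∈ B, l x) (1 - (∑ x, u x - ∑ x ∈ B, u x)) with h' | h' <;>
    rw [h, h'] <;> linarith
end

section
/- Let Θ be a finite nonempty set and μ : 2^Θ → ℝ a 2-monotone capacity: μ(∅) = 0, μ(Θ) = 1, μ(A) ≤ μ(B) whenever A ⊆ B, and μ(A ∪ B) + μ(A ∩ B) ≥ μ(A) + μ(B) for all A, B ⊆ Θ. Then μ is a coherent lower probability: the credal set P(μ) = { p probability distribution on Θ : P(A) ≥ μ(A) for all A ⊆ Θ } is nonempty and, for every A ⊆ Θ, there exists p ∈ P(μ) with P(A) = μ(A), so μ(A) = min_{p ∈ P(μ)} P(A). -/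
/-- `p` is nonnegative, sums to `μ S` on `S`, and dominates `μ` on the subsets of `S`. -/
def IsCoreVector {Θ : Type*} (μ : Finset Θ → ℝ) (S : Finset Θ) (p : Θ → ℝ) : Prop :=
  (∀ x, 0 ≤ p x) ∧ ∑ x ∈ S, p x = μ S ∧ ∀ B ⊆ S, μ B ≤ ∑ x ∈ B, p x

/-- Giving a new point its marginal contribution extends a core vector of a monotone
supermodular set function. -/
theorem IsCoreVector.update_insert {Θ : Type*} [DecidableEq Θ] {μ : Finset Θ → ℝ}
    (hmono : ∀ A B : Finset Θ, A ⊆ B → μ A ≤ μ B)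
    (h2mono : ∀ A B : Finset Θ, μ A + μ B ≤ μ (A ∪ B) + μ (A ∩ B))
    {S : Finset Θ} {p : Θ → ℝ} (hp : IsCoreVector μ S p) {a : Θ} (ha : a ∉ S) :
    IsCoreVector μ (insert a S) (Function.update p a (μ (insert a S) - μ S)) := by
  obtain ⟨hnonneg, hsum, hdom⟩ := hp
  have sum_update : ∀ B : Finset Θ, a ∉ B →
      ∑ x ∈ B, Function.update p a (μ (insert a S) - μ S) x = ∑ x ∈ B, p x := fun B hB =>
    Finset.sum_congr rfl fun x hx =>
      Function.update_of_ne (ne_of_mem_of_not_mem hx hB) _ _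
  refine ⟨fun x => ?_, ?_, fun B hB => ?_⟩
  · by_cases hx : x = a
    · subst hx
      simpa using hmono S (insert x S) (Finset.subset_insert x S)
    · simpa [hx] using hnonneg x
  · rw [Finset.sum_insert ha, sum_update S ha, hsum, Function.update_self]
    ring
  · by_cases haB : a ∈ B
    · have hunion : B ∪ S = insert a S := by grind
      have hinter : B ∩ S = B.erase a := by grind
      have hsuper := h2mono B S
      rw [hunion, hinter] at hsuper
      have herase := hdom (B.erase a) (hinter ▸ Finset.inter_subset_right)
      rw [← Finset.add_sum_erase B _ haB, sum_update _ (Finset.notMem_erase a B),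
        Function.update_self]
      linarith
    · rw [sum_update B haB]
      exact hdom B ((Finset.subset_insert_iff_of_notMem haB).1 hB)

/-- A core vector on `S` of a monotone supermodular set function extends to any `S ∪ T`. -/
theorem IsCoreVector.exists_extension {Θ : Type*} [DecidableEq Θ] {μ : Finset Θ → ℝ}
    (hmono : ∀ A B : Finset Θ, A ⊆ B → μ A ≤ μ B)
    (h2mono : ∀ A B : Finset Θ, μ A + μ B ≤ μ (A ∪ B) + μ (A ∩ B))
    {S : Finset Θ} {p : Θ → ℝ} (hp : IsCoreVector μ S p) (T : Finset Θ) :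
    ∃ q : Θ → ℝ, IsCoreVector μ (S ∪ T) q ∧ ∀ x ∈ S, q x = p x := by
  induction T using Finset.induction_on with
  | empty => exact ⟨p, by simpa using hp, fun _ _ => rfl⟩
  | insert a T _ ih =>
    obtain ⟨q, hq, hqp⟩ := ih
    rw [Finset.union_insert]
    by_cases ha : a ∈ S ∪ T
    · exact ⟨q, by rwa [Finset.insert_eq_of_mem ha], hqp⟩
    · refine ⟨_, hq.update_insert hmono h2mono ha, fun x hx => ?_⟩
      have hxa : x ≠ a := fun h => ha (h ▸ Finset.mem_union_left T hx)
      rw [Function.update_of_ne hxa, hqp x hx]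

/-- A 2-monotone capacity on a finite set is a coherent lower probability: its credal
set is nonempty and the capacity is the (attained) lower envelope of the credal set. -/
theorem two_monotone_coherent {Θ : Type*} [Fintype Θ] [DecidableEq Θ] [Nonempty Θ]
    (μ : Finset Θ → ℝ)
    (h0 : μ ∅ = 0) (h1 : μ Finset.univ = 1)
    (hmono : ∀ A B : Finset Θ, A ⊆ B → μ A ≤ μ B)
    (h2mono : ∀ A B : Finset Θ, μ A + μ B ≤ μ (A ∪ B) + μ (A ∩ B)) :
    (∃ p : Θ → ℝ, (∀ x, 0 ≤ p x) ∧ (∑ x, p x) = 1 ∧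
        ∀ A : Finset Θ, μ A ≤ ∑ x ∈ A, p x) ∧
    ∀ A : Finset Θ,
      IsLeast {r : ℝ | ∃ p : Θ → ℝ, (∀ x, 0 ≤ p x) ∧ (∑ x, p x) = 1 ∧
        (∀ B : Finset Θ, μ B ≤ ∑ x ∈ B, p x) ∧ r = ∑ x ∈ A, p x} (μ A) := by
  have attained : ∀ A : Finset Θ, ∃ p : Θ → ℝ, (∀ x, 0 ≤ p x) ∧ (∑ x, p x) = 1 ∧
      (∀ B : Finset Θ, μ B ≤ ∑ x ∈ B, p x) ∧ μ A = ∑ x ∈ A, p x := by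
    intro A
    have hempty : IsCoreVector μ ∅ 0 :=
      ⟨fun _ => le_rfl, by simp [h0], fun B hB => by simp [Finset.subset_empty.1 hB, h0]⟩
    obtain ⟨p, hp, -⟩ := hempty.exists_extension hmono h2mono A
    rw [Finset.empty_union] at hp
    obtain ⟨q, hq, hqp⟩ := hp.exists_extension hmono h2mono Finset.univ
    rw [Finset.union_eq_right.2 (Finset.subset_univ A)] at hq
    exact ⟨q, hq.1, hq.2.1.trans h1, fun B => hq.2.2 B (Finset.subset_univ B),
      by rw [Finset.sum_congr rfl hqp, hp.2.1]⟩
  refine ⟨?_, fun A => ⟨attained A, ?_⟩⟩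
  · obtain ⟨p, hnonneg, hsum, hdom, -⟩ := attained ∅
    exact ⟨p, hnonneg, hsum, hdom⟩
  · rintro r ⟨p, -, -, hdom, rfl⟩
    exact hdom A
end

section
/- Let Θ be a finite nonempty set and P_ : 2^Θ → ℝ a lower probability. Then the credal set P(P_) = { p probability distribution on Θ : P(A) ≥ P_(A) for all A ⊆ Θ } is nonempty if and only if P_ avoids sure loss, i.e. for every n ≥ 1 and all events A_1, ..., A_n ⊆ Θ, max_{θ ∈ Θ} ∑_{i=1}^n 1_{A_i}(θ) ≥ ∑_{i=1}^n P_(A_i), where 1_{A_i} denotes the indicator function of A_i. -/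
/-- Nonnegative real weights making finitely many linear forms negative can be replaced by
natural-number weights. -/
lemma exists_nat_weights_of_uniform_neg {ι κ : Type*} [Fintype ι] [Fintype κ]
    (g : κ → ι → ℝ) (c : ι → ℝ) (hc : ∀ i, 0 ≤ c i) (u : ℝ) (hu : u < 0)
    (h : ∀ k, ∑ i, c i * g k i ≤ u) :
    ∃ m : ι → ℕ, ∀ k, ∑ i, (m i : ℝ) * g k i < 0 := by
  obtain ⟨N, hN⟩ := exists_nat_gt ((∑ k, ∑ i, |g k i|) / (-u))
  rw [div_lt_iff₀ (by linarith)] at hN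
  refine ⟨fun i => ⌊(N : ℝ) * c i⌋₊, fun k => ?_⟩
  have hround : ∑ i, (⌊(N : ℝ) * c i⌋₊ : ℝ) * g k i ≤
      ∑ i, ((N : ℝ) * (c i * g k i) + |g k i|) := by
    refine Finset.sum_le_sum fun i _ => ?_
    have h1 := Nat.floor_le (mul_nonneg (Nat.cast_nonneg N) (hc i))
    have h2 := Nat.lt_floor_add_one ((N : ℝ) * c i)
    have h3 : |((⌊(N : ℝ) * c i⌋₊ : ℝ) - N * c i)| ≤ 1 := abs_le.2 ⟨by linarith, by linarith⟩
    have h4 : ((⌊(N : ℝ) * c i⌋₊ : ℝ) - N * c i) * g k i ≤ 1 * |g k i| :=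
      (le_abs_self _).trans (by rw [abs_mul]; gcongr)
    linarith
  rw [Finset.sum_add_distrib, ← Finset.mul_sum] at hround
  have hk : ∑ i, |g k i| ≤ ∑ k, ∑ i, |g k i| :=
    Finset.single_le_sum (f := fun k => ∑ i, |g k i|)
      (fun _ _ => Finset.sum_nonneg fun _ _ => abs_nonneg _) (Finset.mem_univ k)
  have hNu := mul_le_mul_of_nonneg_left (h k) (Nat.cast_nonneg (α := ℝ) N)
  linarith

/-- A theorem of the alternative: either the image of the standard simplex under an affine map
meets the nonnegative orthant, or some nonnegative weights are uniformly negative on the images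
of the vertices. -/
lemma exists_mem_stdSimplex_nonneg_or_exists_weights {ι κ : Type*} [Fintype ι] [Fintype κ]
    [DecidableEq κ] (g : κ → ι → ℝ) :
    (∃ p ∈ stdSimplex ℝ κ, ∀ i, 0 ≤ ∑ k, p k * g k i) ∨
      ∃ c : ι → ℝ, (∀ i, 0 ≤ c i) ∧ ∃ u < 0, ∀ k, ∑ i, c i * g k i ≤ u := by
  classical
  by_cases hp : ∃ p ∈ stdSimplex ℝ κ, ∀ i, 0 ≤ ∑ k, p k * g k i
  · exact Or.inl hp
  right
  let L : (κ → ℝ) →ₗ[ℝ] (ι → ℝ) := Fintype.linearCombination ℝ g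
  have hL : ∀ p i, L p i = ∑ k, p k * g k i := fun p i => by
    simp [L, Fintype.linearCombination_apply]
  have hdisj : Disjoint (L '' stdSimplex ℝ κ) (Set.Ici 0) := by
    rw [Set.disjoint_left]
    rintro _ ⟨p, hpm, rfl⟩ h0
    exact hp ⟨p, hpm, fun i => by rw [← hL]; exact h0 i⟩
  obtain ⟨f, u, v, hfu, huv, hfv⟩ := geometric_hahn_banach_compact_closed
    ((convex_stdSimplex ℝ κ).linear_image L)
    ((isCompact_stdSimplex (𝕜 := ℝ) κ).image L.continuous_of_finiteDimensional)
    (convex_Ici (𝕜 := ℝ) (0 : ι → ℝ)) isClosed_Ici hdisj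
  have hv : v < 0 := by simpa using hfv 0 Set.self_mem_Ici
  refine ⟨fun i => f (Pi.single i 1), fun i => ?_, u, huv.trans hv, fun k => ?_⟩
  · by_contra! hneg
    have hmem : (v / f (Pi.single i 1)) • (Pi.single i 1 : ι → ℝ) ∈ Set.Ici (0 : ι → ℝ) :=
      Set.mem_Ici.2 <| smul_nonneg (div_nonneg_of_nonpos hv.le hneg.le) (Pi.single_nonneg.2 zero_le_one)
    have := hfv _ hmem
    rw [map_smul, smul_eq_mul, div_mul_cancel₀ _ hneg.ne] at this
    exact lt_irrefl _ this
  · have hk := hfu _ ⟨_, single_mem_stdSimplex ℝ k, rfl⟩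
    have hLk : L (Pi.single k 1) = g k := by
      simp [L]
    rw [hLk, ← LinearMap.sum_single_apply (fun _ => ℝ) (g k)] at hk
    refine le_of_eq_of_le ?_ hk.le
    rw [map_sum]
    refine Finset.sum_congr rfl fun i _ => ?_
    have : (Pi.single i (g k i) : ι → ℝ) = g k i • Pi.single i 1 := by
      rw [← Pi.single_smul, smul_eq_mul, mul_one]
    simp [this, mul_comm]

/-- A lower probability has a nonempty credal set iff it avoids sure loss. -/
theorem credal_nonempty_iff_avoids_sure_loss {Θ : Type*} [Fintype Θ] [DecidableEq Θ]
    [Nonempty Θ]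
    (Plow : Finset Θ → ℝ) :
    (∃ p : Θ → ℝ, (∀ x, 0 ≤ p x) ∧ (∑ x, p x) = 1 ∧
        ∀ A : Finset Θ, Plow A ≤ ∑ x ∈ A, p x) ↔
    (∀ n : ℕ, 1 ≤ n → ∀ A : Fin n → Finset Θ,
      ∃ θ : Θ, ∑ i, Plow (A i) ≤ ∑ i, (if θ ∈ A i then (1 : ℝ) else 0)) := by
  constructor
  · rintro ⟨p, hp0, hp1, hpA⟩ n - A
    by_contra! hlt
    set S := ∑ i, Plow (A i)
    have hle : S ≤ ∑ x, p x * ∑ i, (if x ∈ A i then (1 : ℝ) else 0) := by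
      simp_rw [Finset.mul_sum]
      rw [Finset.sum_comm]
      refine Finset.sum_le_sum fun i _ => (hpA _).trans_eq ?_
      simp
    have hx : ∃ x, 0 < p x := by
      by_contra! hneg
      have := Finset.sum_nonpos fun x (_ : x ∈ Finset.univ) => hneg x
      linarith
    obtain ⟨x, hx⟩ := hx
    have hstrict : ∑ x, p x * ∑ i, (if x ∈ A i then (1 : ℝ) else 0) < ∑ x, p x * S :=
      Finset.sum_lt_sum (fun y _ => mul_le_mul_of_nonneg_left (hlt y).le (hp0 y))
        ⟨x, Finset.mem_univ x, mul_lt_mul_of_pos_left (hlt x) hx⟩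
    rw [← Finset.sum_mul, hp1, one_mul] at hstrict
    exact absurd hle hstrict.not_ge
  · intro h
    rcases exists_mem_stdSimplex_nonneg_or_exists_weights
      (fun (θ : Θ) (A : Finset Θ) => (if θ ∈ A then (1 : ℝ) else 0) - Plow A) with
      ⟨p, ⟨hp0, hp1⟩, hp⟩ | ⟨c, hc, u, hu, hcu⟩
    · refine ⟨p, hp0, hp1, fun A => ?_⟩
      have := hp A
      simp only [mul_sub, Finset.sum_sub_distrib, ← Finset.sum_mul, hp1, one_mul] at this
      simpa using this
    · obtain ⟨m, hm⟩ := exists_nat_weights_of_uniform_neg _ c hc u hu hcu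
      let e := Fintype.equivFin (Σ A : Finset Θ, Fin (m A))
      have hsum : ∀ F : Finset Θ → ℝ, ∑ i, F (e.symm i).1 = ∑ A, (m A : ℝ) * F A := fun F => by
        rw [e.symm.sum_comp (fun s => F s.1), Fintype.sum_sigma]
        simp
      have hpos : 1 ≤ Fintype.card (Σ A : Finset Θ, Fin (m A)) := by
        by_contra! hcard
        have hm0 : ∀ A, m A = 0 := by simpa using hcard
        simpa [hm0] using hm (Classical.arbitrary Θ)
      obtain ⟨θ, hθ⟩ := h _ hpos fun i => (e.symm i).1
      rw [hsum Plow, hsum fun A => if θ ∈ A then (1 : ℝ) else 0] at hθ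
      have := hm θ
      simp only [mul_sub, Finset.sum_sub_distrib] at this
      linarith
end

section
/- Let Θ be a finite nonempty set and P_ : 2^Θ → ℝ a lower probability with nonempty credal set P(P_) = { p probability distribution on Θ : P(A) ≥ P_(A) for all A ⊆ Θ }. Then P_ is coherent, i.e. min_{p ∈ P(P_)} P(A) = P_(A) for every A ⊆ Θ, if and only if for all n, m ≥ 1 and all events A_0, A_1, ..., A_n ⊆ Θ, max_{θ ∈ Θ} [ ∑_{i=1}^n 1_{A_i}(θ) − m · 1_{A_0}(θ) ] ≥ ∑_{i=1}^n P_(A_i) − m · P_(A_0). -/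
/-- **Gordan-type alternative**: either some probability vector has nonnegative expectation under
every `v j`, or some nonnegative combination of the `v j` is everywhere negative. -/
theorem exists_stdSimplex_nonneg_or_exists_neg_combination {Θ J : Type*} [Fintype Θ] [Fintype J]
    (v : J → Θ → ℝ) :
    (∃ p ∈ stdSimplex ℝ Θ, ∀ j, 0 ≤ ∑ x, p x * v j x) ∨
      ∃ w : J → ℝ, (∀ j, 0 ≤ w j) ∧ ∀ x, ∑ j, w j * v j x < 0 := by
  classical
  refine or_iff_not_imp_left.mpr fun h => ?_
  push Not at h
  let T : (Θ → ℝ) →ₗ[ℝ] (J → ℝ) :=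
    LinearMap.pi fun j => ∑ x, v j x • LinearMap.proj x
  have hT (p : Θ → ℝ) (j : J) : T p j = ∑ x, p x * v j x := by
    simp [T, mul_comm]
  obtain ⟨f, hf, hneg⟩ := (ProperCone.positive ℝ (J → ℝ)).hyperplane_separation
    ((convex_stdSimplex ℝ Θ).linear_image T)
    ((isCompact_stdSimplex ℝ Θ).image T.continuous_of_finiteDimensional) (by
      rw [Set.disjoint_left]
      rintro _ ⟨p, hp, rfl⟩ hpos
      obtain ⟨j, hj⟩ := h p hp
      have := ProperCone.mem_positive.mp hpos j
      rw [hT] at this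
      exact absurd this (not_le.mpr hj))
  refine ⟨fun j => f (Pi.single j 1), fun j => hf _ ?_, fun x => ?_⟩
  · exact ProperCone.mem_positive.mpr (Pi.single_nonneg.mpr zero_le_one)
  · have hx := hneg _ ⟨Pi.single x 1, single_mem_stdSimplex ℝ x, rfl⟩
    rw [← f.coe_coe, LinearMap.pi_apply_eq_sum_univ] at hx
    convert hx using 2 with j
    have hsingle : (Pi.single j 1 : J → ℝ) = fun i => if j = i then 1 else 0 := by
      ext i
      simp [Pi.single_apply, eq_comm]
    rw [hT, ← hsingle, mul_comm]
    simp [Pi.single_apply]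

/-- A real nonnegative combination of finitely many vectors that is everywhere negative can be
replaced by one with positive integer weights. -/
theorem exists_pos_nat_neg_combination {Θ J : Type*} [Finite Θ] [Fintype J]
    (v : J → Θ → ℝ) (w : J → ℝ) (hw : ∀ j, 0 ≤ w j) (hneg : ∀ x, ∑ j, w j * v j x < 0) :
    ∃ k : J → ℕ, (∀ j, 1 ≤ k j) ∧ ∀ x, ∑ j, (k j : ℝ) * v j x < 0 := by
  have hev : ∀ᶠ N : ℕ in Filter.atTop,
      ∀ x, ∑ j, |v j x| < N * -(∑ j, w j * v j x) := by
    rw [Filter.eventually_all]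
    intro x
    exact (tendsto_natCast_atTop_atTop.atTop_mul_const (neg_pos.mpr (hneg x))).eventually_gt_atTop _
  obtain ⟨N, hN⟩ := hev.exists
  refine ⟨fun j => ⌊N * w j⌋₊ + 1, fun j => Nat.le_add_left _ _, fun x => ?_⟩
  have hle : ∑ j, ((⌊N * w j⌋₊ + 1 : ℕ) : ℝ) * v j x
      ≤ ∑ j, (N * (w j * v j x) + |v j x|) := by
    refine Finset.sum_le_sum fun j _ => ?_
    have h₁ := Nat.floor_le (mul_nonneg N.cast_nonneg (hw j))
    have h₂ := Nat.lt_floor_add_one (N * w j)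
    have h₃ : |((⌊N * w j⌋₊ + 1 : ℕ) : ℝ) - N * w j| ≤ 1 := by
      push_cast
      rw [abs_le]
      constructor <;> linarith
    have h₄ : |(((⌊N * w j⌋₊ + 1 : ℕ) : ℝ) - N * w j) * v j x| ≤ |v j x| := by
      rw [abs_mul]
      exact mul_le_of_le_one_left (abs_nonneg _) h₃
    linarith [le_of_abs_le h₄]
  rw [Finset.sum_add_distrib, ← Finset.mul_sum] at hle
  linarith [hN x]

/-- A finite multiset given by multiplicities can be listed as a family indexed by `Fin n`. -/
theorem exists_fin_enumeration_of_multiplicity {β : Type*} [Fintype β] (k : β → ℕ) :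
    ∃ a : Fin (∑ b, k b) → β, ∀ f : β → ℝ, ∑ i, f (a i) = ∑ b, (k b : ℝ) * f b := by
  let e : Fin (∑ b, k b) ≃ Σ b, Fin (k b) := (Fintype.equivFinOfCardEq (by simp)).symm
  refine ⟨fun i => (e i).1, fun f => ?_⟩
  rw [e.sum_comp fun s => f s.1, Fintype.sum_sigma]
  simp


/-- A lower probability with nonempty credal set is coherent (it is the attained lower
envelope of its credal set) iff Walley's coherence condition on events holds. -/
theorem coherent_iff_walley_condition {Θ : Type*} [Fintype Θ] [DecidableEq Θ]
    [Nonempty Θ]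
    (Plow : Finset Θ → ℝ)
    (hne : ∃ p : Θ → ℝ, (∀ x, 0 ≤ p x) ∧ (∑ x, p x) = 1 ∧
        ∀ A : Finset Θ, Plow A ≤ ∑ x ∈ A, p x) :
    (∀ A : Finset Θ,
      IsLeast {r : ℝ | ∃ p : Θ → ℝ, (∀ x, 0 ≤ p x) ∧ (∑ x, p x) = 1 ∧
        (∀ B : Finset Θ, Plow B ≤ ∑ x ∈ B, p x) ∧ r = ∑ x ∈ A, p x} (Plow A)) ↔
    (∀ n k : ℕ, 1 ≤ n → 1 ≤ k → ∀ (A₀ : Finset Θ) (A : Fin n → Finset Θ),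
      ∃ θ : Θ,
        (∑ i, Plow (A i)) - (k : ℝ) * Plow A₀ ≤
          (∑ i, (if θ ∈ A i then (1 : ℝ) else 0)) -
            (k : ℝ) * (if θ ∈ A₀ then (1 : ℝ) else 0)) := by
  constructor
  · intro hcoh n k _ _ A₀ A
    obtain ⟨p, hp, hsum, hlow, heq⟩ := (hcoh A₀).1
    by_contra! hlt
    have hexp (B : Finset Θ) : ∑ x, p x * (if x ∈ B then (1 : ℝ) else 0) = ∑ x ∈ B, p x := by
      simp
    obtain ⟨x₀, hx₀⟩ : ∃ x, 0 < p x := by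
      by_contra! hle
      linarith [Finset.sum_nonpos fun x (_ : x ∈ Finset.univ) => hle x]
    have hmean : ∑ x, p x * ((∑ i, (if x ∈ A i then (1 : ℝ) else 0)) -
        (k : ℝ) * (if x ∈ A₀ then (1 : ℝ) else 0)) <
        ∑ x, p x * ((∑ i, Plow (A i)) - (k : ℝ) * Plow A₀) :=
      Finset.sum_lt_sum (fun x _ => mul_le_mul_of_nonneg_left (hlt x).le (hp x))
        ⟨x₀, Finset.mem_univ _, mul_lt_mul_of_pos_left (hlt x₀) hx₀⟩
    rw [← Finset.sum_mul, hsum, one_mul] at hmean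
    simp only [mul_sub, Finset.sum_sub_distrib, Finset.mul_sum,
      mul_left_comm (p _) (k : ℝ)] at hmean
    rw [Finset.sum_comm, ← Finset.mul_sum, hexp, ← heq] at hmean
    simp only [hexp] at hmean
    linarith [Finset.sum_le_sum fun i (_ : i ∈ Finset.univ) => hlow (A i)]
  · intro hW A₀
    refine ⟨?_, by rintro _ ⟨p, _, _, hlow, rfl⟩; exact hlow A₀⟩
    let ind (B : Finset Θ) (x : Θ) : ℝ := if x ∈ B then 1 else 0
    let v : Option (Finset Θ) → Θ → ℝ := fun j x =>
      j.elim (Plow A₀ - ind A₀ x) fun B => ind B x - Plow B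
    rcases exists_stdSimplex_nonneg_or_exists_neg_combination v with
      ⟨p, ⟨hp, hsum⟩, hv⟩ | ⟨w, hw, hneg⟩
    · have hlow (B : Finset Θ) : Plow B ≤ ∑ x ∈ B, p x := by
        simpa [v, ind, mul_sub, ← Finset.sum_mul, hsum] using hv (some B)
      refine ⟨p, hp, hsum, hlow, (hlow A₀).antisymm ?_⟩
      simpa [v, ind, mul_sub, ← Finset.sum_mul, hsum] using hv none
    · obtain ⟨k, hk, hkneg⟩ := exists_pos_nat_neg_combination v w hw hneg
      obtain ⟨A, hA⟩ := exists_fin_enumeration_of_multiplicity fun B => k (some B)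
      have hn : 1 ≤ ∑ B, k (some B) :=
        (hk (some ∅)).trans
          (Finset.single_le_sum (f := fun B => k (some B)) (fun _ _ => Nat.zero_le _)
            (Finset.mem_univ ∅))
      obtain ⟨x, hx⟩ := hW _ (k none) hn (hk none) A₀ A
      have hlt := hkneg x
      rw [hA Plow, hA fun B => if x ∈ B then (1 : ℝ) else 0] at hx
      simp only [Fintype.sum_option, v, ind, Option.elim, mul_sub, Finset.sum_sub_distrib] at hlt
      linarith
end

section
/- Let Θ be a finite nonempty set and P : (Θ → ℝ) → ℝ a functional on gambles. Call P a coherent prevision if for every finite family of gambles X_1, ..., X_n and every choice of real numbers c_1, ..., c_n, the gain G(θ) = ∑_{k=1}^n c_k (P(X_k) − X_k(θ)) satisfies min_{θ ∈ Θ} G(θ) ≤ 0. Then P is a coherent prevision if and only if: (1) P is linear, P(λX + μY) = λP(X) + μP(Y) for all gambles X, Y and reals λ, μ; (2) P is positive, P(X) ≥ 0 whenever X(θ) > 0 for all θ; and (3) P is normalized, P(1) = 1 where 1 is the constant gamble equal to one. -/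
/-- De Finetti: a prevision on the gambles over a finite nonempty set is coherent
iff it is linear, positive on strictly positive gambles, and normalized. -/
theorem coherent_prevision_iff_linear_positive_normalized
    {Θ : Type*} [Fintype Θ] [Nonempty Θ]
    (P : (Θ → ℝ) → ℝ) :
    (∀ (n : ℕ) (X : Fin n → Θ → ℝ) (c : Fin n → ℝ),
      ∃ θ : Θ, ∑ k, c k * (P (X k) - X k θ) ≤ 0) ↔
    ((∀ (X Y : Θ → ℝ) (a b : ℝ),
        P (fun θ => a * X θ + b * Y θ) = a * P X + b * P Y) ∧
      (∀ X : Θ → ℝ, (∀ θ : Θ, 0 < X θ) → 0 ≤ P X) ∧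
      P (fun _ => 1) = 1) := by
  constructor
  · intro h
    refine ⟨fun X Y a b => ?_, fun X hX => ?_, ?_⟩
    · obtain ⟨θ, hθ⟩ := h 3 ![fun θ => a * X θ + b * Y θ, X, Y] ![1, -a, -b]
      obtain ⟨η, hη⟩ := h 3 ![fun θ => a * X θ + b * Y θ, X, Y] ![-1, a, b]
      simp [Fin.sum_univ_three] at hθ hη
      linarith
    · obtain ⟨θ, hθ⟩ := h 1 ![X] ![-1]
      simp at hθ
      linarith [hX θ]
    · obtain ⟨θ, hθ⟩ := h 1 ![fun _ => 1] ![1]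
      obtain ⟨η, hη⟩ := h 1 ![fun _ => 1] ![-1]
      simp at hθ hη
      linarith
  · rintro ⟨hlin, hpos, hone⟩ n X c
    by_contra! hG
    let L : (Θ → ℝ) →ₗ[ℝ] ℝ :=
      { toFun := P
        map_add' := fun X Y => by simpa [← Pi.add_def] using hlin X Y 1 1
        map_smul' := fun a X => by
          simpa [Pi.smul_def] using hlin X 0 a 0 }
    have hL : ∀ Z, L Z = P Z := fun _ => rfl
    have hL_one : L 1 = 1 := hone
    let G : Θ → ℝ := ∑ k, c k • (P (X k) • (1 : Θ → ℝ) - X k)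
    have hG_apply : ∀ θ, G θ = ∑ k, c k * (P (X k) - X k θ) := fun θ => by
      simp [G, Finset.sum_apply]
    have hLG : L G = 0 := by
      simp only [G, map_sum, map_smul, map_sub, hL_one, hL (X _)]
      simp
    obtain ⟨θ₀, hmin⟩ := Finite.exists_min G
    have hG₀ : 0 < G θ₀ := by rw [hG_apply]; exact hG θ₀
    have hshift : 0 ≤ L (G - (G θ₀ / 2) • (1 : Θ → ℝ)) := hpos _ fun θ => by
      have := hmin θ
      simp only [Pi.sub_apply, Pi.smul_apply, Pi.one_apply, smul_eq_mul, mul_one]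
      linarith
    rw [map_sub, map_smul, hLG, hL_one, smul_eq_mul] at hshift
    linarith
end
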